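/- EUKF-A sigma-point covariance identity: if A is invertible and B satisfies B·Bᵀ = n·(P + A⁻¹·Q·(A⁻¹)ᵀ), then X̃·W_d·X̃ᵀ = A·P·Aᵀ + Q, where X̃ is the perturbation matrix of the ensemble obtained by propagating the sigma points of X(x̂, α, B) through x ↦ A·x + u. -/

import Mathlib

open Matrix

/-- UKF weight vector `W ∈ ℝ^{2n+1}`. -/
noncomputable def ukfW (n : ℕ) (α : ℝ) : Fin (2*n+1) → ℝ :=
  fun i => if i.val = 0 then (α^2 - 1)/α^2 else 1/(2*α^2*n)

/-- Perturbation matrix `Δ(α, B)`: first column 0, next n columns `α·bᵢ`,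
last n columns `−α·bᵢ`. -/
noncomputable def ukfDelta (n : ℕ) (α : ℝ) (B : Matrix (Fin n) (Fin n) ℝ) :
    Matrix (Fin n) (Fin (2*n+1)) ℝ :=
  Matrix.of fun i j =>
    if h0 : j.val = 0 then 0
    else if h1 : j.val ≤ n then α * B i ⟨j.val - 1, by omega⟩
    else -(α * B i ⟨j.val - n - 1, by have := j.isLt; omega⟩)

/-- Sigma-point matrix `X(x̂, α, B)`: j-th column is `x̂` plus the j-th column of `Δ(α, B)`. -/
noncomputable def sigmaPts {n : ℕ} (xhat : Fin n → ℝ) (α : ℝ)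
    (B : Matrix (Fin n) (Fin n) ℝ) : Matrix (Fin n) (Fin (2*n+1)) ℝ :=
  Matrix.of fun i j => xhat i + ukfDelta n α B i j

/-- Affine propagation of an ensemble: j-th column of the result is `A·(j-th column of X) + u`. -/
noncomputable def propagate {n : ℕ} (A : Matrix (Fin n) (Fin n) ℝ) (u : Fin n → ℝ)
    (X : Matrix (Fin n) (Fin (2*n+1)) ℝ) : Matrix (Fin n) (Fin (2*n+1)) ℝ :=
  Matrix.of fun i j => A.mulVec (fun r => X r j) i + u i

/-- Deviation matrix `X̃ = X − (X·W)·1ᵀ`. -/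
noncomputable def devMat {q m : ℕ} (w : Fin m → ℝ) (X : Matrix (Fin q) (Fin m) ℝ) :
    Matrix (Fin q) (Fin m) ℝ :=
  X - Matrix.vecMulVec (X.mulVec w) (fun _ => 1)

/-- Posterior covariance as a function of the gain:
`P(K̂) = P_prior + K̂·R̄·K̂ᵀ − K̂·C·P_prior − P_prior·Cᵀ·K̂ᵀ`. -/
noncomputable def postCov {n p : ℕ} (Pprior : Matrix (Fin n) (Fin n) ℝ)
    (C : Matrix (Fin p) (Fin n) ℝ) (Rbar : Matrix (Fin p) (Fin p) ℝ)
    (K : Matrix (Fin n) (Fin p) ℝ) : Matrix (Fin n) (Fin n) ℝ :=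
  Pprior + K * Rbar * Kᵀ - K * C * Pprior - Pprior * Cᵀ * Kᵀ

theorem Fin.sum_univ_two_mul_add_one {M : Type*} [AddCommMonoid M] (n : ℕ)
    (f : Fin (2 * n + 1) → M) :
    ∑ j, f j = f 0 + ∑ i : Fin n,
      (f ⟨i.val + 1, by omega⟩ + f ⟨n + i.val + 1, by omega⟩) := by
  rw [Fin.sum_univ_succ, Finset.sum_add_distrib,
    ← Equiv.sum_comp (finCongr (two_mul n).symm), Fin.sum_univ_add]
  rfl

section UkfWeights

variable {n : ℕ} {α : ℝ} (B : Matrix (Fin n) (Fin n) ℝ)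

theorem ukfDelta_zero (i : Fin n) : ukfDelta n α B i 0 = 0 := by
  simp [ukfDelta]

theorem ukfDelta_left (i k : Fin n) :
    ukfDelta n α B i ⟨k.val + 1, by omega⟩ = α * B i k := by
  have hk : k.val + 1 ≤ n := k.isLt
  simp [ukfDelta, hk]

theorem ukfDelta_right (i k : Fin n) :
    ukfDelta n α B i ⟨n + k.val + 1, by omega⟩ = -(α * B i k) := by
  have hk : ¬ n + k.val + 1 ≤ n := by omega
  have hs : n + k.val + 1 - n - 1 = k.val := by omega
  simp [ukfDelta, hk, hs]

theorem ukfW_zero : ukfW n α 0 = (α ^ 2 - 1) / α ^ 2 := by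
  simp [ukfW]

theorem ukfW_succ (k : ℕ) (hk : k + 1 < 2 * n + 1) :
    ukfW n α ⟨k + 1, hk⟩ = 1 / (2 * α ^ 2 * n) := by
  simp [ukfW]

theorem sum_ukfW (hn : 0 < n) (hα : α ≠ 0) : ∑ j, ukfW n α j = 1 := by
  have hn' : (n : ℝ) ≠ 0 := by positivity
  rw [Fin.sum_univ_two_mul_add_one]
  simp only [ukfW_zero, ukfW_succ, Finset.sum_const, Finset.card_univ, Fintype.card_fin,
    nsmul_eq_mul]
  field_simp
  ring

theorem ukfDelta_mulVec_ukfW : ukfDelta n α B *ᵥ ukfW n α = 0 := by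
  ext i
  simp only [Matrix.mulVec, dotProduct, Pi.zero_apply]
  rw [Fin.sum_univ_two_mul_add_one]
  simp [ukfDelta_zero, ukfDelta_left, ukfDelta_right, ukfW_succ]

theorem ukfDelta_mul_diagonal_mul_transpose (hα : α ≠ 0) :
    ukfDelta n α B * diagonal (ukfW n α) * (ukfDelta n α B)ᵀ = (n : ℝ)⁻¹ • (B * Bᵀ) := by
  ext i j
  rw [Matrix.smul_apply, smul_eq_mul, Matrix.mul_apply, Matrix.mul_apply, Finset.mul_sum,
    Fin.sum_univ_two_mul_add_one]
  simp only [Matrix.mul_diagonal, Matrix.transpose_apply]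
  simp only [ukfDelta_zero, ukfDelta_left, ukfDelta_right, ukfW_succ, zero_mul, zero_add]
  refine Finset.sum_congr rfl fun k _ => ?_
  have hn' : (n : ℝ) ≠ 0 := by
    have := k.pos
    positivity
  field_simp
  ring

end UkfWeights

theorem propagate_sigmaPts {n : ℕ} (A : Matrix (Fin n) (Fin n) ℝ) (xhat u : Fin n → ℝ) (α : ℝ)
    (B : Matrix (Fin n) (Fin n) ℝ) :
    propagate A u (sigmaPts xhat α B) =
      A * ukfDelta n α B + vecMulVec (A *ᵥ xhat + u) (fun _ => 1) := by
  ext i j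
  simp only [propagate, sigmaPts, Matrix.mulVec, dotProduct, Matrix.of_apply, mul_add,
    Finset.sum_add_distrib, Matrix.add_apply, Matrix.mul_apply, vecMulVec_apply, Pi.add_apply]
  ring

/-- Subtracting the weighted mean removes a common shift of all columns when the weights
sum to one. -/
theorem devMat_add_vecMulVec_one {q m : ℕ} {w : Fin m → ℝ} (hw : ∑ j, w j = 1)
    {X : Matrix (Fin q) (Fin m) ℝ} (hX : X *ᵥ w = 0) (v : Fin q → ℝ) :
    devMat w (X + vecMulVec v (fun _ => 1)) = X := by
  have hv : vecMulVec v (fun _ => 1) *ᵥ w = v := by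
    ext i
    simp [Matrix.mulVec, dotProduct, vecMulVec_apply, ← Finset.mul_sum, hw]
  rw [devMat, Matrix.add_mulVec, hX, hv, zero_add, add_sub_cancel_right]

theorem stmt16 {n : ℕ} (hn : 0 < n)
    (A : Matrix (Fin n) (Fin n) ℝ) (hA : IsUnit A)
    (Q P : Matrix (Fin n) (Fin n) ℝ) (hQ : Q.PosSemidef) (hP : P.PosSemidef)
    (xhat u : Fin n → ℝ) (α : ℝ) (hα : α ≠ 0)
    (B : Matrix (Fin n) (Fin n) ℝ)
    (hB : B * Bᵀ = (n : ℝ) • (P + A⁻¹ * Q * (A⁻¹)ᵀ))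
    (Xt : Matrix (Fin n) (Fin (2*n+1)) ℝ)
    (hXt : Xt = devMat (ukfW n α) (propagate A u (sigmaPts xhat α B))) :
    Xt * Matrix.diagonal (ukfW n α) * Xtᵀ = A * P * Aᵀ + Q := by
  have hn' : (n : ℝ) ≠ 0 := by positivity
  have hdet : IsUnit A.det := (Matrix.isUnit_iff_isUnit_det A).mp hA
  have hmean : (A * ukfDelta n α B) *ᵥ ukfW n α = 0 := by
    rw [← Matrix.mulVec_mulVec, ukfDelta_mulVec_ukfW, Matrix.mulVec_zero]
  rw [propagate_sigmaPts, devMat_add_vecMulVec_one (sum_ukfW hn hα) hmean] at hXt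
  have hAt : (A⁻¹)ᵀ * Aᵀ = 1 := by
    rw [← Matrix.transpose_mul, Matrix.mul_nonsing_inv A hdet, Matrix.transpose_one]
  calc Xt * diagonal (ukfW n α) * Xtᵀ
      = A * (ukfDelta n α B * diagonal (ukfW n α) * (ukfDelta n α B)ᵀ) * Aᵀ := by
        rw [hXt, Matrix.transpose_mul]
        simp only [Matrix.mul_assoc]
    _ = A * (P + A⁻¹ * Q * (A⁻¹)ᵀ) * Aᵀ := by
        rw [ukfDelta_mul_diagonal_mul_transpose B hα, hB, inv_smul_smul₀ hn']
    _ = A * P * Aᵀ + (A * A⁻¹) * Q * ((A⁻¹)ᵀ * Aᵀ) := by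
        simp only [Matrix.mul_add, Matrix.add_mul, Matrix.mul_assoc]
    _ = A * P * Aᵀ + Q := by
        rw [Matrix.mul_nonsing_inv A hdet, hAt, Matrix.one_mul, Matrix.mul_one]
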